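/- arXiv:2212.07109 — 2 statements merged into one kernel-verified Lean document; each statement's English description precedes it below -/
import Mathlib

section
/- For all sufficiently large n, set k = ⌊n/3⌋ and let I be the interval of integers [2n² − n + 66, k² + (k−1)k(2k−1)/3 − 66]. Then an integer m ∈ I is the additive energy of some n-element set of integers if and only if m ≡ n (mod 4); that is, I ∩ {E(A) : A ⊆ ℤ, |A| = n} = {m ∈ I : m ≡ n (mod 4)}. -/
/-- The additive energy of a finite set `A`: the number of quadruples
`(a₁, a₂, a₃, a₄) ∈ A⁴` with `a₁ + a₂ = a₃ + a₄`. -/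
def addEnergy {α : Type*} [DecidableEq α] [Add α] (A : Finset α) : ℕ :=
  (((A ×ˢ A) ×ˢ A ×ˢ A).filter fun p => p.1.1 + p.1.2 = p.2.1 + p.2.2).card

/-- The number of solutions of `x + y = z + w` with one variable in each of four finite sets. -/
def quadCount (X Y Z W : Finset ℤ) : ℕ :=
  ∑ x ∈ X, ∑ y ∈ Y, ∑ z ∈ Z, ∑ w ∈ W, if x + y = z + w then 1 else 0

lemma addEnergy_eq_quadCount (A : Finset ℤ) : addEnergy A = quadCount A A A A := by
  simp only [addEnergy, quadCount, Finset.card_filter, Finset.sum_product]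

lemma quadCount_comm_left (X Y Z W : Finset ℤ) : quadCount X Y Z W = quadCount Y X Z W := by
  unfold quadCount
  rw [Finset.sum_comm]
  simp only [add_comm]

lemma quadCount_swap (X Y Z W : Finset ℤ) : quadCount X Y Z W = quadCount Z W X Y := by
  have h := Finset.sum_comm (s := X ×ˢ Y) (t := Z ×ˢ W)
    (f := fun p q => if p.1 + p.2 = q.1 + q.2 then 1 else 0)
  simp only [Finset.sum_product] at h
  unfold quadCount
  rw [h]
  simp only [eq_comm]

lemma quadCount_comm_right (X Y Z W : Finset ℤ) : quadCount X Y Z W = quadCount X Y W Z := by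
  rw [quadCount_swap, quadCount_comm_left, quadCount_swap]

lemma quadCount_union₁ {A B : Finset ℤ} (h : Disjoint A B) (Y Z W : Finset ℤ) :
    quadCount (A ∪ B) Y Z W = quadCount A Y Z W + quadCount B Y Z W :=
  Finset.sum_union h

lemma quadCount_union₂ {A B : Finset ℤ} (h : Disjoint A B) (X Z W : Finset ℤ) :
    quadCount X (A ∪ B) Z W = quadCount X A Z W + quadCount X B Z W := by
  simp only [quadCount_comm_left X, quadCount_union₁ h]

lemma quadCount_union₃ {A B : Finset ℤ} (h : Disjoint A B) (X Y W : Finset ℤ) :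
    quadCount X Y (A ∪ B) W = quadCount X Y A W + quadCount X Y B W := by
  simp only [quadCount_swap X, quadCount_union₁ h]

lemma quadCount_union₄ {A B : Finset ℤ} (h : Disjoint A B) (X Y Z : Finset ℤ) :
    quadCount X Y Z (A ∪ B) = quadCount X Y Z A + quadCount X Y Z B := by
  simp only [quadCount_comm_right X Y Z, quadCount_union₃ h]

lemma quadCount_eq_zero {X Y Z W : Finset ℤ}
    (h : ∀ x ∈ X, ∀ y ∈ Y, ∀ z ∈ Z, ∀ w ∈ W, x + y ≠ z + w) : quadCount X Y Z W = 0 :=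
  Finset.sum_eq_zero fun x hx => Finset.sum_eq_zero fun y hy => Finset.sum_eq_zero fun z hz =>
    Finset.sum_eq_zero fun w hw => if_neg (h x hx y hy z hz w hw)

lemma quadCount_eq_card_mul_card {X Y : Finset ℤ}
    (h : ∀ x ∈ X, ∀ y ∈ Y, ∀ z ∈ X, ∀ w ∈ Y, x + y = z + w → x = z) :
    quadCount X Y X Y = X.card * Y.card := by
  have key : quadCount X Y X Y =
      ∑ x ∈ X, ∑ y ∈ Y, ∑ z ∈ X, ∑ w ∈ Y, if x = z then (if y = w then 1 else 0) else 0 := by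
    refine Finset.sum_congr rfl fun x hx => Finset.sum_congr rfl fun y hy =>
      Finset.sum_congr rfl fun z hz => Finset.sum_congr rfl fun w hw => ?_
    have := h x hx y hy z hz w hw
    split_ifs <;> omega
  rw [key, Finset.card_eq_sum_ones X, Finset.card_eq_sum_ones Y, Finset.sum_mul_sum]
  refine Finset.sum_congr rfl fun x hx => Finset.sum_congr rfl fun y hy => ?_
  rw [Finset.sum_eq_single x, Finset.sum_eq_single y] <;> simp_all [eq_comm]

lemma addEnergy_union {A B : Finset ℤ}
    (h₂ : ∀ a ∈ A, ∀ a' ∈ A, ∀ b ∈ B, ∀ b' ∈ B, a + a' ≠ b + b')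
    (h₃ : ∀ a ∈ A, ∀ b ∈ B, ∀ b' ∈ B, ∀ b'' ∈ B, a + b ≠ b' + b'')
    (h₄ : ∀ a ∈ A, ∀ b ∈ B, ∀ a' ∈ A, ∀ b' ∈ B, a + b = a' + b' → a = a') :
    addEnergy (A ∪ B) =
      addEnergy A + addEnergy B + 4 * (A.card * B.card) + 4 * quadCount B A A A := by
  have hd : Disjoint A B := Finset.disjoint_left.2 fun x hA hB => h₂ x hA x hA x hB x hB rfl
  have e₂ := quadCount_eq_zero h₂
  have e₃ := quadCount_eq_zero h₃
  have e₄ := quadCount_eq_card_mul_card h₄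
  have e₂' := quadCount_swap A A B B
  have e₃a := quadCount_comm_left A B B B
  have e₃b := quadCount_swap A B B B
  have e₃c := quadCount_comm_right B B A B
  have e₄a := quadCount_comm_left A B A B
  have e₄b := quadCount_comm_right A B A B
  have e₄c := quadCount_comm_left A B B A
  have e₁a := quadCount_comm_left B A A A
  have e₁b := quadCount_swap B A A A
  have e₁c := quadCount_comm_right A A B A
  simp only [addEnergy_eq_quadCount, quadCount_union₁ hd, quadCount_union₂ hd,
    quadCount_union₃ hd, quadCount_union₄ hd]
  omega

lemma addEnergy_insert_of_lt {A : Finset ℤ} {x : ℤ} (h : ∀ a ∈ A, a < x) :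
    addEnergy (insert x A) = addEnergy A + 1 + 4 * A.card + 4 * quadCount {x} A A A := by
  have hx : addEnergy {x} = 1 := by simp [addEnergy, Finset.filter_singleton]
  have := addEnergy_union (A := A) (B := {x}) ?_ ?_ ?_
  · rw [Finset.insert_eq, Finset.union_comm, this, hx, Finset.card_singleton, mul_one]
  · intro a ha a' ha' b hb b' hb'
    have := h a ha
    have := h a' ha'
    simp only [Finset.mem_singleton] at hb hb'
    omega
  · intro a ha b hb b' hb' b'' hb''
    have := h a ha
    simp only [Finset.mem_singleton] at hb hb' hb''
    omega
  · intro a ha b hb a' ha' b' hb'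
    simp only [Finset.mem_singleton] at hb hb'
    omega

lemma addEnergy_mod_four (A : Finset ℤ) : addEnergy A % 4 = A.card % 4 := by
  induction A using Finset.induction_on_max with
  | empty => simp [addEnergy]
  | insert x s hs ih =>
    rw [addEnergy_insert_of_lt hs, Finset.card_insert_of_notMem fun hx => (hs x hx).false]
    omega

/-- The arithmetic progression `M * c, M * (c + 1), …, M * (c + j - 1)`. -/
def progression (M c : ℤ) (j : ℕ) : Finset ℤ :=
  (Finset.range j).image fun i : ℕ => M * (c + i)

lemma progression_succ (M c : ℤ) (j : ℕ) :
    progression M c (j + 1) = insert (M * (c + j)) (progression M c j) := by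
  simp [progression, Finset.range_add_one]

lemma sum_range_ite_add_eq (j u v : ℕ) (hu : u < j) (hv : v < j) :
    (∑ i ∈ Finset.range j, if j + i = u + v then 1 else 0) = if j ≤ u + v then 1 else 0 := by
  split_ifs with h
  · rw [Finset.sum_eq_single (u + v - j)]
    · rw [if_pos (by omega)]
    · intro b _ hb
      rw [if_neg (by omega)]
    · intro hb
      exact absurd (Finset.mem_range.2 (by omega)) hb
  · exact Finset.sum_eq_zero fun i _ => if_neg (by omega)

lemma sum_range_ite_le_add (j u : ℕ) (hu : u < j) :
    (∑ v ∈ Finset.range j, if j ≤ u + v then 1 else 0) = u := by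
  rw [← Finset.card_filter]
  have : (Finset.range j).filter (fun v => j ≤ u + v) = Finset.Ico (j - u) j := by
    ext v
    simp only [Finset.mem_filter, Finset.mem_range, Finset.mem_Ico]
    omega
  rw [this, Nat.card_Ico]
  omega

lemma progression_injective {M : ℤ} (hM : 0 < M) (c : ℤ) :
    Function.Injective fun i : ℕ => M * (c + i) := by
  intro a b hab
  have := mul_left_cancel₀ hM.ne' hab
  omega

lemma card_progression {M : ℤ} (hM : 0 < M) (c : ℤ) (j : ℕ) : (progression M c j).card = j := by
  rw [progression, Finset.card_image_of_injective _ (progression_injective hM c),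
    Finset.card_range]

lemma quadCount_progression {M : ℤ} (hM : 0 < M) (c : ℤ) (j : ℕ) :
    quadCount {M * (c + j)} (progression M c j) (progression M c j) (progression M c j) =
      j.choose 2 := by
  have hinj := (progression_injective hM c).injOn (s := (Finset.range j : Set ℕ))
  have hiff : ∀ i u v : ℕ,
      M * (c + j) + M * (c + i) = M * (c + u) + M * (c + v) ↔ j + i = u + v := by
    intro i u v
    rw [← mul_add, ← mul_add, mul_right_inj' hM.ne']
    omega
  simp only [quadCount, progression, Finset.sum_singleton, Finset.sum_image hinj, hiff]
  rw [Finset.sum_comm]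
  have : ∀ u ∈ Finset.range j, (∑ i ∈ Finset.range j, ∑ v ∈ Finset.range j,
      if j + i = u + v then 1 else 0) = u := by
    intro u hu
    rw [Finset.mem_range] at hu
    rw [Finset.sum_comm, Finset.sum_congr rfl fun v hv =>
      sum_range_ite_add_eq j u v hu (Finset.mem_range.1 hv), sum_range_ite_le_add j u hu]
  rw [Finset.sum_congr rfl this, Finset.sum_range_id, Nat.choose_two_right]

lemma addEnergy_progression {M : ℤ} (hM : 0 < M) (c : ℤ) (j : ℕ) :
    addEnergy (progression M c j) + j = 2 * j ^ 2 + 4 * j.choose 3 := by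
  induction j with
  | zero => simp [progression, addEnergy]
  | succ j ih =>
    have hlt : ∀ a ∈ progression M c j, a < M * (c + j) := by
      intro a ha
      simp only [progression, Finset.mem_image, Finset.mem_range] at ha
      obtain ⟨i, hi, rfl⟩ := ha
      exact mul_lt_mul_of_pos_left (by omega) hM
    rw [progression_succ, addEnergy_insert_of_lt hlt, card_progression hM,
      quadCount_progression hM, Nat.choose_succ_succ' j 2]
    linarith

/-- Some `n`-element set of integers has additive energy `2 * n ^ 2 - n + 4 * t`. -/
def HasExcess (n t : ℕ) : Prop :=
  ∃ A : Finset ℤ, A.card = n ∧ addEnergy A + n = 2 * n ^ 2 + 4 * t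

lemma HasExcess.add_choose {n t : ℕ} (h : HasExcess n t) (j : ℕ) :
    HasExcess (n + j) (t + j.choose 3) := by
  obtain ⟨A, hA, hE⟩ := h
  obtain ⟨L, hL⟩ : ∃ L : ℤ, ∀ a ∈ A, |a| ≤ L := by
    obtain ⟨L, hL⟩ := (A.image fun a => |a|).bddAbove
    exact ⟨L, fun a ha => hL (by simpa using ⟨a, ha, rfl⟩)⟩
  set M : ℤ := 4 * |L| + 1 with hMdef
  have hM : 0 < M := by positivity
  have hA' : ∀ a ∈ A, -M < 4 * a ∧ 4 * a < M := by
    intro a ha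
    have h₁ := abs_le.1 (hL a ha)
    have h₂ := le_abs_self L
    omega
  have hB : ∀ b ∈ progression M (2 * j + 1) j, ∃ i : ℤ, 2 * j + 1 ≤ i ∧ i ≤ 3 * j ∧ b = M * i := by
    intro b hb
    simp only [progression, Finset.mem_image, Finset.mem_range] at hb
    obtain ⟨i, hi, rfl⟩ := hb
    exact ⟨2 * j + 1 + i, by omega, by omega, rfl⟩
  have hsmall : ∀ y i : ℤ, -M < y → y < M → y = M * i → i = 0 := by
    intro y i h₁ h₂ h₃
    have h₄ : i < 1 := by nlinarith
    have h₅ : -1 < i := by nlinarith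
    omega
  have hU := addEnergy_union (A := A) (B := progression M (2 * j + 1) j) ?_ ?_ ?_
  · have hN : quadCount (progression M (2 * j + 1) j) A A A = 0 := by
      refine quadCount_eq_zero fun b hb a₁ h₁ a₂ h₂ a₃ h₃ he => ?_
      obtain ⟨i, hi, -, rfl⟩ := hB b hb
      have := hA' a₁ h₁
      have := hA' a₂ h₂
      have := hA' a₃ h₃
      have := hsmall (a₂ + a₃ - a₁) i (by omega) (by omega) (by linarith)
      omega
    have hP := addEnergy_progression hM (2 * j + 1) j
    have hd : Disjoint A (progression M (2 * j + 1) j) := by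
      refine Finset.disjoint_left.2 fun a ha hb => ?_
      obtain ⟨i, hi, -, hai⟩ := hB a hb
      have := hA' a ha
      have := hsmall a i (by omega) (by omega) hai
      omega
    refine ⟨A ∪ progression M (2 * j + 1) j, ?_, ?_⟩
    · rw [Finset.card_union_of_disjoint hd, hA, card_progression hM]
    · rw [hU, hN, hA, card_progression hM]
      linarith
  · intro a₁ h₁ a₂ h₂ b₁ k₁ b₂ k₂ he
    obtain ⟨i₁, hi₁, -, rfl⟩ := hB b₁ k₁
    obtain ⟨i₂, hi₂, -, rfl⟩ := hB b₂ k₂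
    have := hA' a₁ h₁
    have := hA' a₂ h₂
    have := hsmall (a₁ + a₂) (i₁ + i₂) (by omega) (by omega) (by linarith)
    omega
  · intro a ha b₁ k₁ b₂ k₂ b₃ k₃ he
    obtain ⟨i₁, hi₁, hi₁', rfl⟩ := hB b₁ k₁
    obtain ⟨i₂, hi₂, hi₂', rfl⟩ := hB b₂ k₂
    obtain ⟨i₃, hi₃, hi₃', rfl⟩ := hB b₃ k₃
    have := hA' a ha
    have := hsmall a (i₂ + i₃ - i₁) (by omega) (by omega) (by linarith)
    omega
  · intro a₁ h₁ b₁ k₁ a₂ h₂ b₂ k₂ he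
    obtain ⟨i₁, -, -, rfl⟩ := hB b₁ k₁
    obtain ⟨i₂, -, -, rfl⟩ := hB b₂ k₂
    have := hA' a₁ h₁
    have := hA' a₂ h₂
    have hi := hsmall (a₁ - a₂) (i₂ - i₁) (by omega) (by omega) (by linarith)
    obtain rfl : i₂ = i₁ := by omega
    linarith

lemma hasExcess_zero (n : ℕ) : HasExcess n 0 := by
  induction n with
  | zero => exact ⟨∅, by simp [addEnergy]⟩
  | succ n ih => exact ih.add_choose 1

lemma hasExcess_of_three_mul_le {n t : ℕ} (h : 3 * t ≤ n) : HasExcess n t := by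
  induction t generalizing n with
  | zero => exact hasExcess_zero n
  | succ t ih =>
    obtain ⟨m, rfl⟩ : ∃ m, n = m + 3 := ⟨n - 3, by omega⟩
    exact (ih (by omega)).add_choose 3

lemma succ_choose_three (k : ℕ) : (k + 1).choose 3 = k.choose 2 + k.choose 3 :=
  Nat.choose_succ_succ' k 2

lemma exists_eq_choose_three_add {k t : ℕ} (h : t ≤ (k + 1).choose 3) :
    ∃ m r, m ≤ k ∧ t = m.choose 3 + r ∧ r ≤ m.choose 2 := by
  induction k with
  | zero => exact ⟨0, 0, le_rfl, by simpa [Nat.choose] using h, by simp⟩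
  | succ k ih =>
    by_cases hk : t ≤ (k + 1).choose 3
    · obtain ⟨m, r, hm, ht, hr⟩ := ih hk
      exact ⟨m, r, by omega, ht, hr⟩
    · rw [succ_choose_three (k + 1)] at h
      exact ⟨k + 1, t - (k + 1).choose 3, le_rfl, by omega, by omega⟩

lemma succ_choose_two_mul_two (m : ℕ) : (m + 1).choose 2 * 2 = (m + 1) * m := by
  rw [Nat.choose_two_right]
  exact Nat.div_mul_cancel (Nat.even_mul_pred_self (m + 1)).two_dvd

lemma six_mul_choose_three (m : ℕ) : 6 * (m + 2).choose 3 = (m + 2) * (m + 1) * m := by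
  induction m with
  | zero => rfl
  | succ m ih =>
    have := succ_choose_two_mul_two (m + 1)
    rw [succ_choose_three]
    linarith

lemma choose_two_le_choose_three {i : ℕ} (hi : 26 ≤ i) :
    i.choose 2 ≤ (i / 2 + 1).choose 3 := by
  obtain ⟨j, hj⟩ : ∃ j, i / 2 = j + 13 := ⟨i / 2 - 13, by omega⟩
  have h₁ : i.choose 2 ≤ (2 * j + 26 + 1).choose 2 := Nat.choose_le_choose 2 (by omega)
  have h₂ := succ_choose_two_mul_two (2 * j + 26)
  have h₃ := six_mul_choose_three (j + 12)
  rw [hj]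
  refine h₁.trans ?_
  nlinarith [Nat.zero_le (j ^ 3), Nat.zero_le (j ^ 2)]

lemma hasExcess_of_le_choose {i t n : ℕ} (ht : t ≤ (i + 1).choose 3)
    (hn : 5 * i + 15600 ≤ 2 * n) : HasExcess n t := by
  induction i using Nat.strong_induction_on generalizing t n with
  | _ i ih =>
    rcases lt_or_ge i 26 with hi | hi
    · have h₁ : (i + 1).choose 3 ≤ Nat.choose 26 3 := Nat.choose_le_choose 3 (by omega)
      have h₂ : Nat.choose 26 3 = 2600 := by decide
      exact hasExcess_of_three_mul_le (by omega)
    · obtain ⟨m, r, hm, rfl, hr⟩ := exists_eq_choose_three_add ht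
      have hr' : r ≤ (i / 2 + 1).choose 3 :=
        hr.trans ((Nat.choose_le_choose 2 hm).trans (choose_two_le_choose_three hi))
      obtain ⟨l, rfl⟩ : ∃ l, n = l + m := ⟨n - m, by omega⟩
      rw [add_comm (m.choose 3)]
      exact (ih (i / 2) (by omega) hr' (by omega)).add_choose m

/-- For all sufficiently large `n`, with `k = ⌊n/3⌋`, an integer `m` in the interval
`[2n² − n + 66, k² + (k−1)k(2k−1)/3 − 66]` is the additive energy of some `n`-element
set of integers if and only if `m ≡ n (mod 4)`. -/
theorem energy_interval_ap :
    ∃ N : ℕ, ∀ n : ℕ, N ≤ n →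
      ∀ m : ℕ, 2 * n ^ 2 - n + 66 ≤ m →
        m ≤ (n / 3) ^ 2 + (n / 3 - 1) * (n / 3) * (2 * (n / 3) - 1) / 3 - 66 →
        ((∃ A : Finset ℤ, A.card = n ∧ addEnergy A = m) ↔ m % 4 = n % 4) := by
  refine ⟨46800, fun n hn m hlow hupp => ⟨?_, fun hmod => ?_⟩⟩
  · rintro ⟨A, rfl, rfl⟩
    exact addEnergy_mod_four A
  · obtain ⟨k, hk⟩ : ∃ k, n / 3 = k + 2 := ⟨n / 3 - 2, by omega⟩
    have hsq : n ≤ n ^ 2 := Nat.le_self_pow (by norm_num) n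
    have hn4 : (2 * n ^ 2) % 4 = (2 * n) % 4 := by
      have := (Nat.even_mul_pred_self n).two_dvd
      have h₂ : n ^ 2 = n * (n - 1) + n := by
        obtain ⟨l, rfl⟩ : ∃ l, n = l + 1 := ⟨n - 1, by omega⟩
        simp only [Nat.add_sub_cancel]
        ring
      omega
    obtain ⟨t, ht⟩ : ∃ t, m + n = 2 * n ^ 2 + 4 * t := ⟨(m + n - 2 * n ^ 2) / 4, by omega⟩
    have htle : t ≤ (k + 2).choose 3 := by
      have h₆ := six_mul_choose_three k
      have hdiv := Nat.div_mul_le_self ((k + 1) * (k + 2) * (2 * k + 3)) 3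
      rw [hk, show k + 2 - 1 = k + 1 by omega, show 2 * (k + 2) - 1 = 2 * k + 3 by omega] at hupp
      have hupp' := hupp.trans (Nat.sub_le _ _)
      obtain ⟨s, rfl⟩ : ∃ s, n = 3 * (k + 2) + s := ⟨n - 3 * (k + 2), by omega⟩
      nlinarith [Nat.zero_le (s * k), Nat.zero_le (s ^ 2)]
    obtain ⟨A, hA, hE⟩ := hasExcess_of_le_choose (i := k + 1) (n := n) htle (by omega)
    exact ⟨A, hA, by omega⟩
end

section
/- There is an absolute constant c > 0 such that for all sufficiently large n, writing k = ⌊n/3⌋, the number of distinct values E(A) with A ⊆ ℤ, |A| = n, and E(A) > k² + (k−1)k(2k−1)/3 is at least c·n². -/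
/-- The number of triples `(a, b, c) ∈ A³` with `x + a = b + c`. -/
def tripleCount (A : Finset ℤ) (x : ℤ) : ℕ :=
  ((A ×ˢ A ×ˢ A).filter fun p => x + p.1 = p.2.1 + p.2.2).card

lemma addEnergy_eq_sum (A : Finset ℤ) :
    addEnergy A = ∑ a ∈ A, ∑ b ∈ A, ∑ c ∈ A, ∑ d ∈ A, if a + b = c + d then 1 else 0 := by
  simp only [addEnergy, Finset.card_filter, Finset.sum_product]

lemma tripleCount_eq_sum (A : Finset ℤ) (x : ℤ) :
    tripleCount A x = ∑ a ∈ A, ∑ b ∈ A, ∑ c ∈ A, if x + a = b + c then 1 else 0 := by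
  simp only [tripleCount, Finset.card_filter, Finset.sum_product]

/-- Adjoining an element larger than all of `A`. -/
lemma addEnergy_insert {A : Finset ℤ} {x : ℤ} (hx : ∀ a ∈ A, a < x) :
    addEnergy (insert x A) = addEnergy A + 4 * tripleCount A x + 4 * A.card + 1 := by
  have hxA : x ∉ A := fun h => lt_irrefl x (hx x h)
  have h₁ : ∑ a ∈ A, ∑ b ∈ A, ∑ c ∈ A, (if a + x = b + c then 1 else 0) = tripleCount A x := by
    simp only [tripleCount_eq_sum, add_comm x]
  have h₂ : ∑ a ∈ A, ∑ b ∈ A, ∑ c ∈ A, (if a + b = x + c then 1 else 0) = tripleCount A x := by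
    rw [tripleCount_eq_sum, Finset.sum_comm_cycle]
    simp only [eq_comm]
  have h₃ : ∑ a ∈ A, ∑ b ∈ A, ∑ c ∈ A, (if a + b = c + x then 1 else 0) = tripleCount A x := by
    rw [← h₂]
    simp only [add_comm x]
  have h₄ : ∑ a ∈ A, ∑ b ∈ A, (if x + x = a + b then 1 else 0) = 0 :=
    Finset.sum_eq_zero fun a ha => Finset.sum_eq_zero fun b hb =>
      if_neg (by linarith [hx a ha, hx b hb])
  have h₅ : ∑ a ∈ A, ∑ b ∈ A, (if a + b = x + x then 1 else 0) = 0 := by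
    simpa only [eq_comm] using h₄
  have h₆ : ∑ a ∈ A, (if x = a then 1 else 0) = 0 := by simp [hxA]
  have h₇ : ∑ a ∈ A, (if a = x then 1 else 0) = 0 := by simp [hxA]
  have h₈ : ∑ a ∈ A, ∑ b ∈ A, (if a = b then 1 else 0) = A.card := by simp
  have h₉ : ∑ a ∈ A, ∑ b ∈ A, (if x + a = b + x then 1 else 0) = A.card := by
    simp [add_comm x]
  have h₁₀ : ∑ a ∈ A, ∑ b ∈ A, (if a + x = x + b then 1 else 0) = A.card := by
    simp [add_comm x]
  rw [addEnergy_eq_sum, addEnergy_eq_sum]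
  simp only [Finset.sum_insert hxA, Finset.sum_add_distrib, add_right_inj, add_left_inj,
    h₁, h₂, h₃, h₄, h₅, h₆, h₇, h₈, h₉, h₁₀, ← tripleCount_eq_sum, if_true]
  ring

lemma tripleCount_Ico {m i : ℕ} (h : i ≤ m) :
    tripleCount (Finset.Ico 0 (m : ℤ)) (2 * m - i) = i.choose 2 := by
  rw [Nat.choose_two_right, ← Finset.sum_range_id]
  have hs : ∑ v ∈ Finset.range i, v
      = ((Finset.range i).sigma fun v => Finset.range v).card := by simp
  rw [hs, tripleCount]
  refine Finset.card_nbij'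
    (fun p => ⟨(i - 1 - p.1).toNat, (m - 1 - p.2.1).toNat⟩)
    (fun q => (i - 1 - q.1, m - 1 - q.2, m - q.1 + q.2)) ?_ ?_ ?_ ?_
  · rintro ⟨a, b, c⟩ hp
    simp only [Finset.coe_filter, Finset.mem_product, Finset.mem_Ico, Set.mem_ofPred_eq,
      Finset.coe_sigma, Set.mem_sigma_iff, Finset.mem_coe, Finset.mem_range] at hp ⊢
    omega
  · rintro ⟨v, u⟩ hq
    simp only [Finset.coe_filter, Finset.mem_product, Finset.mem_Ico, Set.mem_ofPred_eq,
      Finset.coe_sigma, Set.mem_sigma_iff, Finset.mem_coe, Finset.mem_range] at hq ⊢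
    omega
  · rintro ⟨a, b, c⟩ hp
    simp only [Finset.coe_filter, Finset.mem_product, Finset.mem_Ico, Set.mem_ofPred_eq,
      Prod.mk.injEq] at hp ⊢
    omega
  · rintro ⟨v, u⟩ hq
    simp only [Finset.coe_sigma, Set.mem_sigma_iff, Finset.mem_coe, Finset.mem_range] at hq
    have hv : ((i : ℤ) - 1 - (i - 1 - v)).toNat = v := by omega
    have hu : ((m : ℤ) - 1 - (m - 1 - u)).toNat = u := by omega
    simp only [hv, hu]

lemma addEnergy_Ico_add (m : ℕ) :
    addEnergy (Finset.Ico 0 (m : ℤ)) + m = 2 * m ^ 2 + 4 * m.choose 3 := by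
  induction m with
  | zero => simp [addEnergy]
  | succ m ih =>
    have hI : Finset.Ico 0 ((m + 1 : ℕ) : ℤ) = insert (m : ℤ) (Finset.Ico 0 (m : ℤ)) := by
      ext
      simp only [Finset.mem_Ico, Finset.mem_insert]
      omega
    have hT := tripleCount_Ico (le_refl m)
    rw [show (2 * m - m : ℤ) = m by ring] at hT
    rw [hI, addEnergy_insert fun a ha => (Finset.mem_Ico.mp ha).2, hT, Int.card_Ico,
      Nat.choose_succ_succ' m 2]
    simp only [sub_zero, Int.toNat_natCast]
    linarith

/-- Any set of integers extends to a larger set without creating further coincidences. -/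
lemma exists_card_eq_add_addEnergy (A : Finset ℤ) (d : ℕ) :
    ∃ B : Finset ℤ, B.card = A.card + d ∧
      addEnergy B + 2 * A.card ^ 2 + B.card = addEnergy A + 2 * B.card ^ 2 + A.card := by
  induction d with
  | zero => exact ⟨A, rfl, rfl⟩
  | succ d ih =>
    obtain ⟨B, hB, hE⟩ := ih
    obtain ⟨M, hM⟩ : ∃ M : ℤ, ∀ b ∈ B, |b| ≤ M :=
      ⟨∑ b ∈ B, |b|, fun b hb => Finset.single_le_sum (fun c _ => abs_nonneg c) hb⟩
    have hlt : ∀ b ∈ B, b < 3 * |M| + 1 := fun b hb => by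
      linarith [hM b hb, le_abs_self b, le_abs_self M, abs_nonneg M]
    have hT : tripleCount B (3 * |M| + 1) = 0 := by
      rw [tripleCount, Finset.card_eq_zero, Finset.filter_eq_empty_iff]
      rintro ⟨a, b, c⟩ hp
      simp only [Finset.mem_product] at hp
      have ha := abs_le.mp (hM a hp.1)
      have hb := abs_le.mp (hM b hp.2.1)
      have hc := abs_le.mp (hM c hp.2.2)
      have := le_abs_self M
      dsimp only
      linarith
    refine ⟨insert (3 * |M| + 1) B, ?_, ?_⟩
    · rw [Finset.card_insert_of_notMem fun h => lt_irrefl _ (hlt _ h), hB, add_assoc]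
    · rw [addEnergy_insert hlt, hT, Finset.card_insert_of_notMem fun h => lt_irrefl _ (hlt _ h)]
      linarith

lemma exists_addEnergy_add_eq {n m i : ℕ} (hi : i ≤ m) (hm : m < n) :
    ∃ A : Finset ℤ, A.card = n ∧
      addEnergy A + n = 2 * n ^ 2 + 4 * (m.choose 3 + i.choose 2) := by
  have hlt : ∀ a ∈ Finset.Ico 0 (m : ℤ), a < 2 * m - i := fun a ha => by
    have := (Finset.mem_Ico.mp ha).2
    omega
  have hcard : (insert (2 * m - i : ℤ) (Finset.Ico 0 (m : ℤ))).card = m + 1 := by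
    rw [Finset.card_insert_of_notMem fun h => lt_irrefl _ (hlt _ h)]
    simp
  obtain ⟨B, hB, hE⟩ :=
    exists_card_eq_add_addEnergy (insert (2 * m - i : ℤ) (Finset.Ico 0 (m : ℤ))) (n - (m + 1))
  have hBn : B.card = n := by omega
  refine ⟨B, hBn, ?_⟩
  rw [hcard, hBn, addEnergy_insert hlt, tripleCount_Ico hi, Int.card_Ico] at hE
  simp only [sub_zero, Int.toNat_natCast] at hE
  linarith [addEnergy_Ico_add m]

lemma addEnergy_le_card_pow_four (A : Finset ℤ) : addEnergy A ≤ A.card ^ 4 := by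
  refine (Finset.card_filter_le _ _).trans_eq ?_
  simp only [Finset.card_product]
  ring

lemma choose_two_lt_choose_two {i j : ℕ} (hi : 1 ≤ i) (h : i < j) :
    i.choose 2 < j.choose 2 := by
  have h₁ : (i + 1).choose 2 ≤ j.choose 2 := Nat.choose_le_choose 2 h
  rw [Nat.choose_succ_succ' i 1, Nat.choose_one_right, one_add_one_eq_two] at h₁
  omega

lemma choose_three_add_choose_two_lt {m m' i j : ℕ} (hi : 1 ≤ i) (him : i < m) (h : m < m') :
    m.choose 3 + i.choose 2 < m'.choose 3 + j.choose 2 := by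
  have h₁ : (m + 1).choose 3 ≤ m'.choose 3 := Nat.choose_le_choose 3 h
  rw [Nat.choose_succ_succ' m 2, two_add_one_eq_three] at h₁
  have := choose_two_lt_choose_two hi him
  omega

lemma injOn_choose_three_add_choose_two :
    Set.InjOn (fun p : ℕ × ℕ => p.1.choose 3 + p.2.choose 2) {p | 1 ≤ p.2 ∧ p.2 < p.1} := by
  rintro ⟨m, i⟩ ⟨hi, him⟩ ⟨m', j⟩ ⟨hj, hjm⟩ h
  dsimp only at hi him hj hjm h
  rcases lt_trichotomy m m' with hm | rfl | hm
  · exact absurd h (choose_three_add_choose_two_lt hi him hm).ne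
  · rcases lt_trichotomy i j with hij | rfl | hij
    · have := choose_two_lt_choose_two hi hij
      omega
    · rfl
    · have := choose_two_lt_choose_two hj hij
      omega
  · exact absurd h (choose_three_add_choose_two_lt hj hjm hm).ne'

lemma sq_add_div_three_eq (k : ℕ) :
    k ^ 2 + (k - 1) * k * (2 * k - 1) / 3 + k = 2 * k ^ 2 + 4 * k.choose 3 := by
  have key : (k - 1) * k * (2 * k - 1) + 3 * k = 3 * (k ^ 2 + 4 * k.choose 3) := by
    induction k with
    | zero => rfl
    | succ k ih =>
      have h2 : 2 * k.choose 2 = k * (k - 1) := by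
        rw [Nat.choose_two_right, Nat.mul_div_cancel' (Nat.even_mul_pred_self k).two_dvd]
      rw [Nat.choose_succ_succ' k 2]
      rcases k with _ | k
      · rfl
      · simp only [Nat.add_sub_cancel, show 2 * (k + 1) - 1 = 2 * k + 1 by omega,
          show 2 * (k + 1 + 1) - 1 = 2 * k + 3 by omega] at ih h2 ⊢
        linarith
  omega

/-- There is an absolute constant `c > 0` such that for all sufficiently large `n`,
with `k = ⌊n/3⌋`, the number of distinct values `E(A)` with `A ⊆ ℤ`, `|A| = n` and
`E(A) > k² + (k−1)k(2k−1)/3` is at least `c·n²`. -/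
theorem energy_many_large_values :
    ∃ c : ℝ, 0 < c ∧ ∃ N : ℕ, ∀ n : ℕ, N ≤ n →
      c * (n : ℝ) ^ 2 ≤
        ({m : ℕ | ∃ A : Finset ℤ, A.card = n ∧ addEnergy A = m ∧
            (n / 3) ^ 2 + (n / 3 - 1) * (n / 3) * (2 * (n / 3) - 1) / 3 < m}).ncard := by
  refine ⟨1 / 20, by norm_num, 20, fun n hn => ?_⟩
  have hk := sq_add_div_three_eq (n / 3)
  obtain ⟨k, hkn⟩ : ∃ k, k = n / 3 := ⟨_, rfl⟩
  rw [← hkn] at hk ⊢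
  set P : Finset (ℕ × ℕ) := Finset.Ico k n ×ˢ Finset.Ico 1 k with hP
  set f : ℕ × ℕ → ℕ := fun p => 2 * n ^ 2 - n + 4 * (p.1.choose 3 + p.2.choose 2) with hf
  have hnn : n ≤ n ^ 2 := Nat.le_self_pow two_ne_zero n
  have hinj : Set.InjOn f P := fun p hp q hq h => by
    simp only [hP, Finset.coe_product, Set.mem_prod, Finset.mem_coe, Finset.mem_Ico] at hp hq
    refine injOn_choose_three_add_choose_two ⟨hp.2.1, by omega⟩ ⟨hq.2.1, by omega⟩ ?_
    simp only [hf] at h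
    dsimp only
    omega
  have hcard : P.card = (n - k) * (k - 1) := by simp [hP]
  have hle : P.card ≤ ({m : ℕ | ∃ A : Finset ℤ, A.card = n ∧ addEnergy A = m ∧
      k ^ 2 + (k - 1) * k * (2 * k - 1) / 3 < m}).ncard := by
    rw [← Finset.card_image_of_injOn hinj, ← Set.ncard_coe_finset]
    refine Set.ncard_le_ncard ?_ ((Set.finite_Iic (n ^ 4)).subset ?_)
    · intro v hv
      obtain ⟨⟨m, i⟩, hp, rfl⟩ := Finset.mem_image.mp (Finset.mem_coe.mp hv)
      simp only [hP, Finset.mem_product, Finset.mem_Ico] at hp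
      obtain ⟨A, hA, hE⟩ := exists_addEnergy_add_eq (by omega : i ≤ m) hp.1.2
      refine ⟨A, hA, ?_, ?_⟩
      · simp only [hf]
        omega
      · have hmono : k.choose 3 ≤ m.choose 3 := Nat.choose_le_choose 3 hp.1.1
        have hsq : 2 * k ^ 2 + n < 2 * n ^ 2 := by
          have : 3 * k ≤ n := by omega
          nlinarith
        simp only [hf]
        omega
    · rintro v ⟨A, rfl, rfl, -⟩
      exact addEnergy_le_card_pow_four A
  refine le_trans ?_ (Nat.cast_le.mpr hle)
  rw [hcard, Nat.cast_mul, Nat.cast_sub (by omega), Nat.cast_sub (by omega), Nat.cast_one]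
  have h₁ : 3 * (k : ℝ) ≤ n := by exact_mod_cast (by omega : 3 * k ≤ n)
  have h₂ : (n : ℝ) ≤ 3 * k + 2 := by exact_mod_cast (by omega : n ≤ 3 * k + 2)
  have h₃ : (20 : ℝ) ≤ n := by exact_mod_cast hn
  have h₄ : 2 / 3 * (n : ℝ) ≤ n - k := by linarith
  have h₅ : 1 / 12 * (n : ℝ) ≤ k - 1 := by linarith
  calc 1 / 20 * (n : ℝ) ^ 2 ≤ (2 / 3 * n) * (1 / 12 * n) := by nlinarith
    _ ≤ (n - k) * (k - 1) := by gcongr; linarith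
end
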